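/- For every odd natural number n ≥ 5 and every k with 2 ≤ k ≤ ⌊n/2⌋, there exists a natural number p ≥ 1 and positive integers c_1, …, c_{⌊n/2⌋} (each c_i ≥ 1) such that μ_{n,k}^p = ∑_{i=1}^{⌊n/2⌋} c_i·μ_{n,i}. -/

import Mathlib

open Real

/-- The length of the `k`-th diagonal of the regular `n`-gon with side length `1`. -/
noncomputable def polygonDiagonal (n k : ℕ) : ℝ :=
  sin (k * π / n) / sin (π / n)

/-- The natural-number combinations of the diagonals of the regular `n`-gon with index in
`[1, n / 2]`. -/
noncomputable def diagonalSpan (n : ℕ) : Submodule ℕ ℝ :=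
  Submodule.span ℕ (polygonDiagonal n '' (Finset.Icc 1 (n / 2) : Finset ℕ))

lemma two_mul_sin_mul_sum_sin (x d : ℝ) (J : ℕ) :
    2 * sin x * ∑ j ∈ Finset.range J, sin ((d + 1 + 2 * j) * x) =
      cos (d * x) - cos ((d + 2 * J) * x) := by
  induction J with
  | zero => simp
  | succ J ih =>
    rw [Finset.sum_range_succ, mul_add, ih]
    have h₁ : (d + 2 * J) * x = (d + 1 + 2 * J) * x - x := by ring
    have h₂ : (d + 2 * (J + 1 : ℕ)) * x = (d + 1 + 2 * J) * x + x := by push_cast; ring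
    rw [h₁, h₂, cos_sub, cos_add]
    ring

lemma sin_pi_div_pos {n : ℕ} (hn : 2 ≤ n) : 0 < sin (π / n) := by
  have hn' : (2 : ℝ) ≤ n := by exact_mod_cast hn
  refine sin_pos_of_pos_of_lt_pi (by positivity) ?_
  rw [div_lt_iff₀ (by linarith)]
  nlinarith [pi_pos]

lemma polygonDiagonal_zero (n : ℕ) : polygonDiagonal n 0 = 0 := by
  simp [polygonDiagonal]

lemma polygonDiagonal_one {n : ℕ} (hn : 2 ≤ n) : polygonDiagonal n 1 = 1 := by
  simp [polygonDiagonal, (sin_pi_div_pos hn).ne']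

lemma polygonDiagonal_sub {n k : ℕ} (hn : 2 ≤ n) (hk : k ≤ n) :
    polygonDiagonal n (n - k) = polygonDiagonal n k := by
  have hn' : (n : ℝ) ≠ 0 := by positivity
  have h : ((n - k : ℕ) : ℝ) * π / n = π - k * π / n := by
    rw [Nat.cast_sub hk]; field_simp
  rw [polygonDiagonal, polygonDiagonal, h, sin_pi_sub]

/-- The diagonal product formula. -/
lemma polygonDiagonal_mul {n : ℕ} (hn : 2 ≤ n) (a d : ℕ) :
    polygonDiagonal n a * polygonDiagonal n (a + d) =
      ∑ j ∈ Finset.range a, polygonDiagonal n (d + 1 + 2 * j) := by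
  have hs := (sin_pi_div_pos hn).ne'
  have key := two_mul_sin_mul_sum_sin (π / n) d a
  have h₁ : (d : ℝ) * (π / n) = (a + d : ℕ) * π / n - a * π / n := by push_cast; ring
  have h₂ : ((d : ℝ) + 2 * a) * (π / n) = (a + d : ℕ) * π / n + a * π / n := by
    push_cast; ring
  rw [h₁, h₂, cos_sub, cos_add] at key
  have h₃ : ∑ j ∈ Finset.range a, polygonDiagonal n (d + 1 + 2 * j) =
      (∑ j ∈ Finset.range a, sin (((d : ℝ) + 1 + 2 * j) * (π / n))) / sin (π / n) := by
    rw [Finset.sum_div]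
    refine Finset.sum_congr rfl fun j _ => ?_
    rw [polygonDiagonal]
    push_cast
    rw [mul_div_assoc]
  rw [h₃, polygonDiagonal, polygonDiagonal, div_mul_div_comm, div_eq_div_iff (mul_ne_zero hs hs) hs]
  linear_combination -sin (π / n) / 2 * key

lemma polygonDiagonal_mem_diagonalSpan {n k : ℕ} (hn : 2 ≤ n) (hk : k ≤ n) :
    polygonDiagonal n k ∈ diagonalSpan n := by
  have half : ∀ i ≤ n / 2, polygonDiagonal n i ∈ diagonalSpan n := by
    intro i hi
    rcases Nat.eq_zero_or_pos i with rfl | hpos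
    · rw [polygonDiagonal_zero]
      exact zero_mem _
    · exact Submodule.subset_span ⟨i, by simpa using ⟨hpos, hi⟩, rfl⟩
  by_cases h : k ≤ n / 2
  · exact half k h
  · rw [← polygonDiagonal_sub hn hk]
    exact half _ (by omega)

lemma mul_mem_diagonalSpan {n : ℕ} (hn : 2 ≤ n) {x y : ℝ} (hx : x ∈ diagonalSpan n)
    (hy : y ∈ diagonalSpan n) : x * y ∈ diagonalSpan n := by
  have ordered : ∀ a d, 2 * a + d ≤ n →
      polygonDiagonal n a * polygonDiagonal n (a + d) ∈ diagonalSpan n := by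
    intro a d h
    rw [polygonDiagonal_mul hn]
    refine sum_mem fun j hj => polygonDiagonal_mem_diagonalSpan hn ?_
    have := Finset.mem_range.1 hj
    omega
  have hxy := Submodule.mul_mem_mul hx hy
  rw [diagonalSpan, Submodule.span_mul_span] at hxy
  refine Submodule.span_le.2 ?_ hxy
  rintro _ ⟨_, ⟨a, ha, rfl⟩, _, ⟨b, hb, rfl⟩, rfl⟩
  simp only [Finset.coe_Icc, Set.mem_Icc] at ha hb
  rcases le_total a b with hab | hab
  · obtain ⟨d, rfl⟩ := Nat.exists_eq_add_of_le hab
    exact ordered a d (by omega)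
  · obtain ⟨d, rfl⟩ := Nat.exists_eq_add_of_le hab
    simpa only [SetLike.mem_coe, mul_comm] using ordered b d (by omega)

lemma exists_sq_polygonDiagonal_eq {n k : ℕ} (hk : 2 ≤ k) (hkn : k ≤ n / 2) :
    ∃ r ∈ diagonalSpan n, polygonDiagonal n k ^ 2 = 1 + polygonDiagonal n 3 + r := by
  have hn : 2 ≤ n := by omega
  obtain ⟨l, rfl⟩ := Nat.exists_eq_add_of_le' hk
  refine ⟨∑ j ∈ Finset.range l, polygonDiagonal n (1 + 2 * (j + 2)),
    sum_mem fun j hj => polygonDiagonal_mem_diagonalSpan hn ?_, ?_⟩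
  · have := Finset.mem_range.1 hj
    omega
  · have h := polygonDiagonal_mul hn (l + 2) 0
    rw [Finset.sum_range_succ', Finset.sum_range_succ'] at h
    simp only [add_zero, zero_add, mul_zero, mul_one, add_assoc, Nat.reduceAdd,
      polygonDiagonal_one hn] at h ⊢
    rw [sq, h]
    ring

lemma exists_polygonDiagonal_three_mul_eq {n t : ℕ} (ht : 2 * t + 3 ≤ n) :
    ∃ r ∈ diagonalSpan n, polygonDiagonal n 3 * polygonDiagonal n (2 * t + 1) =
      polygonDiagonal n (2 * t + 3) + r := by
  have hn : 2 ≤ n := by omega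
  rcases t with _ | t
  · exact ⟨0, zero_mem _, by simp [polygonDiagonal_one hn]⟩
  · refine ⟨polygonDiagonal n (2 * t + 1) + polygonDiagonal n (2 * t + 3),
      add_mem (polygonDiagonal_mem_diagonalSpan hn (by omega))
        (polygonDiagonal_mem_diagonalSpan hn (by omega)), ?_⟩
    rcases t with _ | t
    · have h := polygonDiagonal_mul hn 3 0
      norm_num [Finset.sum_range_succ] at h ⊢
      linarith
    · have h := polygonDiagonal_mul hn 3 (2 * t + 2)
      simp only [Finset.sum_range_succ, Finset.sum_range_zero] at h
      ring_nf at h ⊢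
      linarith

/-- An even power `2 * t` of a nontrivial diagonal dominates all odd diagonals up to index
`2 * t + 1`. -/
lemma exists_pow_polygonDiagonal_eq {n k : ℕ} (hk : 2 ≤ k) (hkn : k ≤ n / 2) (t : ℕ)
    (ht : 2 * t + 1 ≤ n) :
    ∃ r ∈ diagonalSpan n, polygonDiagonal n k ^ (2 * t) =
      ∑ j ∈ Finset.range (t + 1), polygonDiagonal n (2 * j + 1) + r := by
  have hn : 2 ≤ n := by omega
  induction t with
  | zero => exact ⟨0, zero_mem _, by simp [polygonDiagonal_one hn]⟩
  | succ t ih =>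
    obtain ⟨r, hr, hpow⟩ := ih (by omega)
    obtain ⟨q, hq, hsq⟩ := exists_sq_polygonDiagonal_eq hk hkn
    obtain ⟨u, hu, hthree⟩ := exists_polygonDiagonal_three_mul_eq (n := n) (t := t) (by omega)
    have h₃ : polygonDiagonal n 3 ∈ diagonalSpan n :=
      polygonDiagonal_mem_diagonalSpan hn (by omega)
    have hsum : ∀ l ≤ t + 1,
        ∑ j ∈ Finset.range l, polygonDiagonal n (2 * j + 1) ∈ diagonalSpan n := by
      refine fun l hl => sum_mem fun j hj => polygonDiagonal_mem_diagonalSpan hn ?_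
      have := Finset.mem_range.1 hj
      omega
    have hpow_mem : polygonDiagonal n k ^ (2 * t) ∈ diagonalSpan n :=
      hpow ▸ add_mem (hsum _ le_rfl) hr
    refine ⟨r + (u + polygonDiagonal n 3 *
      (∑ j ∈ Finset.range t, polygonDiagonal n (2 * j + 1) + r)) +
      polygonDiagonal n k ^ (2 * t) * q,
      add_mem (add_mem hr (add_mem hu (mul_mem_diagonalSpan hn h₃
        (add_mem (hsum _ (by omega)) hr)))) (mul_mem_diagonalSpan hn hpow_mem hq), ?_⟩
    rw [Finset.sum_range_succ _ (t + 1), show 2 * (t + 1) + 1 = 2 * t + 3 by ring,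
      show 2 * (t + 1) = 2 * t + 2 by ring, pow_add, hsq]
    have hsplit := Finset.sum_range_succ (fun j => polygonDiagonal n (2 * j + 1)) t
    linear_combination (1 + polygonDiagonal n 3) * hpow + polygonDiagonal n 3 * hsplit + hthree

/-- For odd `n`, every diagonal class has exactly one odd representative. -/
lemma sum_odd_polygonDiagonal {n : ℕ} (hn : 2 ≤ n) (hodd : Odd n) :
    ∑ j ∈ Finset.range (n / 2), polygonDiagonal n (2 * j + 1) =
      ∑ i ∈ Finset.Icc 1 (n / 2), polygonDiagonal n i := by
  obtain ⟨m, rfl⟩ := hodd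
  refine Finset.sum_nbij' (fun j => if 2 * j + 1 ≤ m then 2 * j + 1 else 2 * m - 2 * j)
    (fun i => if i % 2 = 1 then i / 2 else m - i / 2) ?_ ?_ ?_ ?_ ?_
  · intro j hj
    simp only [Finset.mem_range, Finset.mem_Icc] at hj ⊢
    split_ifs <;> omega
  · intro i hi
    simp only [Finset.mem_range, Finset.mem_Icc] at hi ⊢
    split_ifs <;> omega
  · intro j hj
    simp only [Finset.mem_range] at hj ⊢
    split_ifs <;> omega
  · intro i hi
    simp only [Finset.mem_Icc] at hi ⊢
    split_ifs <;> omega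
  · intro j hj
    simp only [Finset.mem_range] at hj ⊢
    split_ifs with h
    · rfl
    · rw [← polygonDiagonal_sub hn (by omega)]
      congr 1
      omega

/-- For odd n ≥ 5 and 2 ≤ k ≤ ⌊n/2⌋, some power of μ_{n,k} is a positive integer
combination ∑_{i=1}^{⌊n/2⌋} c_i μ_{n,i} with all c_i ≥ 1. -/
theorem diagonal_power_in_S_full_odd (n : ℕ) (hn : 5 ≤ n) (hodd : Odd n)
    (k : ℕ) (hk : 2 ≤ k) (hkn : k ≤ n / 2) :
    ∃ p : ℕ, 1 ≤ p ∧ ∃ c : ℕ → ℕ, (∀ i ∈ Finset.Icc 1 (n / 2), 1 ≤ c i) ∧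
      (Real.sin (k * Real.pi / n) / Real.sin (Real.pi / n)) ^ p =
        ∑ i ∈ Finset.Icc 1 (n / 2),
          (c i : ℝ) * (Real.sin (i * Real.pi / n) / Real.sin (Real.pi / n)) := by
  obtain ⟨r, hr, hpow⟩ := exists_pow_polygonDiagonal_eq hk hkn (n / 2 - 1) (by omega)
  obtain ⟨c, rfl⟩ := (Submodule.mem_span_image_finset_iff_exists_fun' ℕ).1 hr
  refine ⟨2 * (n / 2 - 1), by omega, fun i => c i + 1, by simp, ?_⟩
  rw [show n / 2 - 1 + 1 = n / 2 by omega, sum_odd_polygonDiagonal (by omega) hodd,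
    ← Finset.sum_add_distrib] at hpow
  refine hpow.trans (Finset.sum_congr rfl fun i _ => ?_)
  rw [nsmul_eq_mul, polygonDiagonal]
  push_cast
  ring
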